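/- Let ε > 0 and set k = ⌈2/ε⌉ and t = ⌈4/ε⌉ + 1. Let s_1, …, s_m form a greedy sequence in E with threshold k, let E' be the set of edges of E that overlap no edge of s_1 ∪ … ∪ s_m, suppose E' contains no run of k consecutive edges, and let M' be a t-locally-optimal consecutive matching in E'. Then ALG := s_1 ∪ … ∪ s_m ∪ M' is a consecutive matching in E, and for every consecutive matching O in E one has (2 + ε)·|ALG| ≥ |O|. -/

import Mathlib

/-- Two edges `(i,j)` and `(i',j')` of the bipartite graph overlap if
`|i - i'| ≤ 1` or `|j - j'| ≤ 1`. -/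
def Overlap {n : ℕ} (e e' : Fin n × Fin n) : Prop :=
  ((e.1.val : ℤ) - e'.1.val).natAbs ≤ 1 ∨ ((e.2.val : ℤ) - e'.2.val).natAbs ≤ 1

instance {n : ℕ} (e e' : Fin n × Fin n) : Decidable (Overlap e e') := by
  unfold Overlap; infer_instance

/-- `M` is a consecutive matching in `E`. -/
def ConsecMatching {n : ℕ} (E M : Finset (Fin n × Fin n)) : Prop :=
  M ⊆ E ∧
  (∀ e ∈ M, ∀ e' ∈ M, e ≠ e' → e.1 ≠ e'.1 ∧ e.2 ≠ e'.2) ∧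
  (∀ e ∈ M, ∀ e' ∈ M, e'.1.val = e.1.val + 1 → e'.2.val = e.2.val + 1) ∧
  (∀ e ∈ M, ∀ e' ∈ M, e'.2.val = e.2.val + 1 → e'.1.val = e.1.val + 1)

/-- `s` is the run of `ℓ` consecutive edges at `(p, q)`,
i.e. `s = {(p+r, q+r) : 0 ≤ r < ℓ}`. -/
def IsRunAt {n : ℕ} (s : Finset (Fin n × Fin n)) (p q ℓ : ℕ) : Prop :=
  p + ℓ ≤ n ∧ q + ℓ ≤ n ∧
  ∀ e : Fin n × Fin n, e ∈ s ↔ ∃ r < ℓ, e.1.val = p + r ∧ e.2.val = q + r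

/-- `s` is a run of `ℓ` consecutive edges. -/
def IsRun {n : ℕ} (s : Finset (Fin n × Fin n)) (ℓ : ℕ) : Prop :=
  ∃ p q, IsRunAt s p q ℓ

/-- `E` contains no run of `k` consecutive edges. -/
def NoRun {n : ℕ} (E : Finset (Fin n × Fin n)) (k : ℕ) : Prop :=
  ¬ ∃ s : Finset (Fin n × Fin n), IsRun s k ∧ s ⊆ E

/-- `s` is a streak of `M`: a run of (at least one) consecutive edges contained in `M`,
maximal under inclusion among runs contained in `M`. -/
def IsStreak {n : ℕ} (M s : Finset (Fin n × Fin n)) : Prop :=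
  (∃ ℓ, 1 ≤ ℓ ∧ IsRun s ℓ) ∧ s ⊆ M ∧
  ∀ s' ℓ', IsRun s' ℓ' → s' ⊆ M → s ⊆ s' → s' = s

/-- `s 0, …, s (m-1)` is a greedy sequence in `E` with threshold `k`:
each `s i` is a run of at least `k` consecutive edges, all of whose edges
overlap no edge of the previously chosen runs, and no run of consecutive
edges all still available at step `i` is longer than `s i`. -/
def GreedySeq {n : ℕ} (E : Finset (Fin n × Fin n)) (k m : ℕ)
    (s : ℕ → Finset (Fin n × Fin n)) : Prop :=
  ∀ i < m,
    s i ⊆ E.filter (fun e => ∀ j < i, ∀ e' ∈ s j, ¬ Overlap e e') ∧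
    (∃ ℓ, k ≤ ℓ ∧ IsRun (s i) ℓ) ∧
    (∀ r ℓ, IsRun r ℓ →
      r ⊆ E.filter (fun e => ∀ j < i, ∀ e' ∈ s j, ¬ Overlap e e') →
      ℓ ≤ (s i).card)

/-- `M` is a `t`-locally-optimal consecutive matching in `E`. -/
def LocallyOptimal {n : ℕ} (E M : Finset (Fin n × Fin n)) (t : ℕ) : Prop :=
  ConsecMatching E M ∧
  ¬ ∃ Erem Eadd : Finset (Fin n × Fin n), Erem ⊆ M ∧ Eadd ⊆ E \ M ∧
      Erem.card < Eadd.card ∧ Eadd.card ≤ t ∧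
      ConsecMatching E ((M \ Erem) ∪ Eadd)

/-- The coordinate of a point on side A (`false`) or on side B (`true`). -/
def side (b : Bool) (x : ℤ × ℤ) : ℤ := bif b then x.2 else x.1

/-- The point `x` shifted by `d` along the diagonal. -/
def diagShift (x : ℤ × ℤ) (d : ℤ) : ℤ × ℤ := (x.1 + d, x.2 + d)

/-- Two points are near if they are at distance at most one on some side. -/
def Near (x y : ℤ × ℤ) : Prop := ∃ b, |side b y - side b x| ≤ 1

/-- Any two near points of `O` lie on a common diagonal. -/
def DiagonalNear (O : Finset (ℤ × ℤ)) : Prop :=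
  ∀ x ∈ O, ∀ y ∈ O, Near x y → y.1 - x.1 = y.2 - x.2

theorem side_diagShift (b : Bool) (x : ℤ × ℤ) (d : ℤ) :
    side b (diagShift x d) = side b x + d := by
  cases b <;> simp [side, diagShift]

theorem diagShift_diagShift (x : ℤ × ℤ) (d d' : ℤ) :
    diagShift (diagShift x d) d' = diagShift x (d + d') := by
  simp [diagShift, add_assoc]

theorem diagShift_zero (x : ℤ × ℤ) : diagShift x 0 = x := by
  simp [diagShift]

theorem DiagonalNear.eq_diagShift {O : Finset (ℤ × ℤ)} (hO : DiagonalNear O) {x y : ℤ × ℤ}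
    (hx : x ∈ O) (hy : y ∈ O) (b : Bool) {d : ℤ} (hd : |d| ≤ 1) (h : side b y = side b x + d) :
    y = diagShift x d := by
  have h1 := hO x hx y hy ⟨b, by rw [h]; simpa using hd⟩
  cases b <;> simp only [side, cond_true, cond_false] at h <;>
    ext <;> simp only [diagShift] <;> omega

theorem DiagonalNear.side_injOn {O : Finset (ℤ × ℤ)} (hO : DiagonalNear O) {x y : ℤ × ℤ}
    (hx : x ∈ O) (hy : y ∈ O) (b : Bool) (h : side b y = side b x) : y = x := by
  have := hO.eq_diagShift hx hy b (d := 0) (by simp) (by simpa using h)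
  rwa [diagShift_zero] at this

/-- Identify the elements of each `e q` with one another: every class then has at most
one element more than there are sets `e q` meeting it. -/
theorem exists_labelling {α β : Type*} [DecidableEq α] [DecidableEq β] (H : Finset α)
    (Q : Finset β) (e : β → Finset α) (he : ∀ q ∈ Q, (e q).card ≤ 2) :
    ∃ c : α → α, (∀ q ∈ Q, ∀ u ∈ e q, ∀ v ∈ e q, c u = c v) ∧
      ∀ a, (H.filter (fun u => c u = a)).card ≤
        (Q.filter (fun q => ∃ u ∈ e q, c u = a)).card + 1 := by
  induction Q using Finset.induction_on with
  | empty =>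
    refine ⟨id, by simp, fun a => ?_⟩
    refine (Finset.card_le_one.2 ?_).trans (Nat.le_add_left _ _)
    simp only [Finset.mem_filter, id]
    rintro x ⟨_, rfl⟩ y ⟨_, rfl⟩
    rfl
  | insert q Q hq ih =>
    obtain ⟨c, hc, hcard⟩ := ih fun p hp => he p (Finset.mem_insert_of_mem hp)
    by_cases hsame : ∀ u ∈ e q, ∀ v ∈ e q, c u = c v
    · refine ⟨c, ?_, fun a => (hcard a).trans ?_⟩
      · intro p hp
        rcases Finset.mem_insert.1 hp with rfl | hp
        · exact hsame
        · exact hc p hp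
      · gcongr
        exact Finset.subset_insert _ _
    · push Not at hsame
      obtain ⟨u, hu, v, hv, huv⟩ := hsame
      have heq : ∀ w ∈ e q, w = u ∨ w = v := by
        intro w hw
        by_contra! hne
        have h3 : ({u, v, w} : Finset α) ⊆ e q := by
          intro z hz
          simp only [Finset.mem_insert, Finset.mem_singleton] at hz
          rcases hz with rfl | rfl | rfl <;> assumption
        have huv' : u ≠ v := fun h => huv (by rw [h])
        have := Finset.card_le_card h3
        rw [Finset.card_eq_three.2 ⟨u, v, w, huv', hne.1.symm, hne.2.symm, rfl⟩] at this
        have := he q (Finset.mem_insert_self _ _)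
        omega
      refine ⟨fun x => if c x = c v then c u else c x, ?_, fun a => ?_⟩
      · intro p hp x hx y hy
        rcases Finset.mem_insert.1 hp with rfl | hp
        · rcases heq x hx with rfl | rfl <;> rcases heq y hy with rfl | rfl <;> simp
        · simp only [hc p hp x hx y hy]
      · beta_reduce
        by_cases hau : a = c u
        · subst hau
          have hH : H.filter (fun x => (if c x = c v then c u else c x) = c u) ⊆
              H.filter (fun x => c x = c u) ∪ H.filter (fun x => c x = c v) := by
            intro x hx
            simp only [Finset.mem_filter, Finset.mem_union] at hx ⊢
            by_cases h : c x = c v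
            · exact Or.inr ⟨hx.1, h⟩
            · exact Or.inl ⟨hx.1, by simpa [h] using hx.2⟩
          have hQ : insert q (Q.filter (fun p => ∃ x ∈ e p, c x = c u) ∪
                Q.filter (fun p => ∃ x ∈ e p, c x = c v)) ⊆
              (insert q Q).filter
                (fun p => ∃ x ∈ e p, (if c x = c v then c u else c x) = c u) := by
            intro p hp
            simp only [Finset.mem_insert, Finset.mem_union, Finset.mem_filter] at hp ⊢
            rcases hp with rfl | ⟨hp, x, hx, hxu⟩ | ⟨hp, x, hx, hxv⟩
            · exact ⟨Or.inl rfl, v, hv, by simp⟩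
            · exact ⟨Or.inr hp, x, hx, by simp [hxu]⟩
            · exact ⟨Or.inr hp, x, hx, by simp [hxv]⟩
          have hdisj : Disjoint (Q.filter (fun p => ∃ x ∈ e p, c x = c u))
              (Q.filter (fun p => ∃ x ∈ e p, c x = c v)) := by
            rw [Finset.disjoint_left]
            intro p hp hp'
            obtain ⟨hpQ, x, hx, hxu⟩ := Finset.mem_filter.1 hp
            obtain ⟨-, y, hy, hyv⟩ := Finset.mem_filter.1 hp'
            exact huv (by rw [← hxu, ← hyv, hc p hpQ x hx y hy])
          have h1 := (Finset.card_le_card hH).trans (Finset.card_union_le _ _)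
          have h2 := Finset.card_le_card hQ
          rw [Finset.card_insert_of_notMem (by simp [hq]),
            Finset.card_union_of_disjoint hdisj] at h2
          have h3 := hcard (c u)
          have h4 := hcard (c v)
          omega
        · by_cases hav : a = c v
          · have : H.filter (fun x => (if c x = c v then c u else c x) = a) = ∅ := by
              rw [Finset.filter_eq_empty_iff]
              intro x _ hx
              split_ifs at hx with h
              · exact hau hx.symm
              · exact h (hx.trans hav)
            rw [this]
            simp
          · have hiff : ∀ x, (if c x = c v then c u else c x) = a ↔ c x = a := by
              intro x
              split_ifs with h
              · exact ⟨fun h' => absurd h'.symm hau, fun h' => absurd (h'.symm.trans h) hav⟩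
              · rfl
            simp only [hiff]
            refine (hcard a).trans ?_
            gcongr
            exact Finset.subset_insert _ _

/-- The map sending every point of `O` to the first point of its streak. -/
theorem exists_streakStart (O : Finset (ℤ × ℤ)) {k : ℕ}
    (hrun : ∀ p : ℤ × ℤ, ∃ j < k, diagShift p (j : ℤ) ∉ O) :
    ∃ st : ℤ × ℤ → ℤ × ℤ,
      (∀ x ∈ O, diagShift x 1 ∈ O → st (diagShift x 1) = st x) ∧
      (∀ x ∈ O, ∀ y ∈ O, st x = st y → diagShift x (-1) ∉ O → diagShift y (-1) ∉ O → x = y) ∧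
      (∀ x ∈ O, ∀ y ∈ O, st x = st y → diagShift x 1 ∉ O → diagShift y 1 ∉ O → x = y) ∧
      (∀ x ∈ O, ∀ y ∈ O, st x = st y → diagShift x (-1) ∉ O → diagShift x 1 ∉ O → x = y) ∧
      (∀ s, (O.filter (fun x => st x = s)).card ≤ k) := by
  classical
  have hex : ∀ x : ℤ × ℤ, ∃ r : ℕ, diagShift x (-(r : ℤ) - 1) ∉ O := by
    intro x
    obtain ⟨j, hj, h⟩ := hrun (diagShift x (-(k : ℤ)))
    refine ⟨k - j - 1, ?_⟩
    rw [diagShift_diagShift] at h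
    convert h using 3
    omega
  let back : ℤ × ℤ → ℕ := fun x => Nat.find (hex x)
  have hback : ∀ x, diagShift x (-(back x : ℤ) - 1) ∉ O := fun x => Nat.find_spec (hex x)
  have hmin : ∀ x, ∀ r < back x, diagShift x (-(r : ℤ) - 1) ∈ O := fun x r hr => by
    simpa using Nat.find_min (hex x) hr
  let st : ℤ × ℤ → ℤ × ℤ := fun x => diagShift x (-(back x : ℤ))
  have hst : ∀ x, x = diagShift (st x) (back x) := fun x => by
    simp [st, diagShift_diagShift, diagShift_zero]
  have hmem : ∀ x ∈ O, ∀ r ≤ back x, diagShift (st x) r ∈ O := by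
    intro x hx r hr
    rcases hr.eq_or_lt with rfl | hr
    · rwa [← hst]
    · have := hmin x (back x - r - 1) (by omega)
      simp only [st, diagShift_diagShift]
      convert this using 2
      omega
  have hprev : ∀ x, diagShift (st x) (-1) ∉ O := by
    intro x
    simpa only [st, diagShift_diagShift, sub_eq_add_neg] using hback x
  have hpos : ∀ x ∈ O, diagShift x (-1) ∉ O → back x = 0 := by
    intro x hx h
    by_contra h0
    have := hmin x 0 (by omega)
    exact h (by simpa using this)
  have hlast : ∀ x ∈ O, ∀ y ∈ O, st x = st y → diagShift x 1 ∉ O → back y ≤ back x := by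
    intro x hx y hy hxy h
    by_contra! hlt
    have := hmem y hy (back x + 1) hlt
    rw [← hxy] at this
    apply h
    rw [hst x, diagShift_diagShift]
    simpa using this
  have hinj : ∀ x y, st x = st y → back x = back y → x = y := by
    intro x y h h'
    rw [hst x, hst y, h, h']
  refine ⟨st, ?_, ?_, ?_, ?_, ?_⟩
  · intro x hx hx1
    have : back (diagShift x 1) = back x + 1 := by
      refine (Nat.find_eq_iff _).2 ⟨?_, ?_⟩
      · rw [diagShift_diagShift]
        convert hback x using 3
        push_cast
        ring
      · intro r hr
        rw [diagShift_diagShift, not_not]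
        rcases Nat.eq_zero_or_pos r with rfl | hr0
        · simpa [diagShift_zero] using hx
        · have := hmin x (r - 1) (by omega)
          convert this using 2
          omega
    simp only [st, this, diagShift_diagShift]
    congr 1
    push_cast
    ring
  · intro x hx y hy h h1 h2
    exact hinj x y h (by rw [hpos x hx h1, hpos y hy h2])
  · intro x hx y hy h h1 h2
    exact hinj x y h (le_antisymm (hlast y hy x hx h.symm h2) (hlast x hx y hy h h1))
  · intro x hx y hy h h1 h2
    have h3 := hpos x hx h1
    have h4 := hlast x hx y hy h h2
    exact hinj x y h (by omega)
  · intro s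
    calc (O.filter (fun x => st x = s)).card
        ≤ ((Finset.range k).image (fun j : ℕ => diagShift s j)).card := by
          apply Finset.card_le_card
          intro x hx
          obtain ⟨hxO, rfl⟩ := Finset.mem_filter.1 hx
          refine Finset.mem_image.2 ⟨back x, ?_, (hst x).symm⟩
          obtain ⟨j, hj, hjO⟩ := hrun (st x)
          rw [Finset.mem_range]
          by_contra! hle
          exact hjO (hmem x hxO j (by omega))
      _ ≤ k := Finset.card_image_le.trans (by simp)

open Classical in
/-- If every set of at most `t` points of `O` is near to at least as many points of `M`, then
`|O| ≤ 2|M| + 2|O|/(t + 1)`. -/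
theorem card_le_of_small_expansion {O M : Finset (ℤ × ℤ)} {t : ℕ} (hO : DiagonalNear O)
    (hrun : ∀ p : ℤ × ℤ, ∃ j < t, diagShift p (j : ℤ) ∉ O)
    (hexp : ∀ X ⊆ O, X.card ≤ t → X.card ≤ (M.filter (fun m => ∃ x ∈ X, Near x m)).card) :
    (t + 1) * O.card ≤ (t + 1) * (2 * M.card) + 2 * O.card := by
  obtain ⟨st, hnext, hfirst, hlast, hsingle, hlen⟩ := exists_streakStart O hrun
  let fib : ℤ × ℤ → Finset (ℤ × ℤ) := fun s => O.filter (fun x => st x = s)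
  let S : Finset (ℤ × ℤ) := O.image st
  let Sides : Finset ((ℤ × ℤ) × Bool) := M ×ˢ Finset.univ
  let I : ℤ × ℤ → Finset ((ℤ × ℤ) × Bool) := fun s =>
    Sides.filter (fun σ => ∃ y ∈ O, st y = s ∧ side σ.2 y = side σ.2 σ.1)
  let Q : Finset ((ℤ × ℤ) × Bool) :=
    Sides.filter (fun σ => ¬ ∃ y ∈ O, side σ.2 y = side σ.2 σ.1)
  have hSides : Sides.card = 2 * M.card := by
    simp [Sides, Finset.card_product, mul_comm]
  have hnext' : ∀ x ∈ O, ∀ d : ℤ, |d| ≤ 1 → diagShift x d ∈ O → st (diagShift x d) = st x := by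
    intro x hx d hd hxd
    have : d = -1 ∨ d = 0 ∨ d = 1 := by
      have := abs_le.1 hd
      omega
    rcases this with rfl | rfl | rfl
    · have h := hnext _ hxd
      rw [diagShift_diagShift, neg_add_cancel, diagShift_zero] at h
      exact (h hx).symm
    · rw [diagShift_zero]
    · exact hnext x hx hxd
  have hIQ : ∑ s ∈ S, (I s).card + Q.card ≤ 2 * M.card := by
    rw [← hSides, ← Finset.card_biUnion, ← Finset.card_union_of_disjoint]
    · apply Finset.card_le_card
      apply Finset.union_subset
      · exact Finset.biUnion_subset.2 fun s _ => Finset.filter_subset _ _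
      · exact Finset.filter_subset _ _
    · rw [Finset.disjoint_left]
      intro σ h1 h2
      obtain ⟨s, -, h1⟩ := Finset.mem_biUnion.1 h1
      obtain ⟨-, y, hy, -, hyσ⟩ := Finset.mem_filter.1 h1
      exact (Finset.mem_filter.1 h2).2 ⟨y, hy, hyσ⟩
    · intro s _ s' _ hne
      rw [Function.onFun, Finset.disjoint_left]
      intro σ h1 h2
      obtain ⟨-, y, hy, rfl, hyσ⟩ := Finset.mem_filter.1 h1
      obtain ⟨-, z, hz, rfl, hzσ⟩ := Finset.mem_filter.1 h2
      exact hne (by rw [hO.side_injOn hy hz σ.2 (hzσ.trans hyσ.symm)])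
  have hnotlast : ∀ s, (fib s).card ≤
      ((fib s).filter (fun x => diagShift x 1 ∈ O)).card + 1 := by
    intro s
    rw [← Finset.card_filter_add_card_filter_not (s := fib s) (fun x => diagShift x 1 ∈ O)]
    gcongr
    refine Finset.card_le_one.2 fun x hx y hy => ?_
    simp only [fib, Finset.mem_filter] at hx hy
    exact hlast x hx.1.1 y hy.1.1 (hx.1.2.trans hy.1.2.symm) hx.2 hy.2
  have hnotfirst : ∀ s, (fib s).card ≤
      ((fib s).filter (fun x => diagShift x (-1) ∈ O)).card + 1 := by
    intro s
    rw [← Finset.card_filter_add_card_filter_not (s := fib s) (fun x => diagShift x (-1) ∈ O)]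
    gcongr
    refine Finset.card_le_one.2 fun x hx y hy => ?_
    simp only [fib, Finset.mem_filter] at hx hy
    exact hfirst x hx.1.1 y hy.1.1 (hx.1.2.trans hy.1.2.symm) hx.2 hy.2
  have hnear : ∀ x ∈ O, ∀ σ ∈ Sides, |side σ.2 σ.1 - side σ.2 x| ≤ 1 →
      diagShift x (side σ.2 σ.1 - side σ.2 x) ∈ O → σ ∈ I (st x) := by
    intro x hx σ hσ hd hmem
    refine Finset.mem_filter.2 ⟨hσ, _, hmem, hnext' x hx _ hd hmem, ?_⟩
    rw [side_diagShift]
    ring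
  have hexcess : ∀ s, (fib s).card ≤ (I s).card + 2 := by
    intro s
    let X := (fib s).filter (fun x => diagShift x 1 ∈ O ∧ diagShift x (-1) ∈ O)
    have hXO : X ⊆ O := fun x hx =>
      (Finset.mem_filter.1 (Finset.mem_filter.1 hx).1).1
    have hXfib : X.card ≤ (fib s).card := Finset.card_le_card (Finset.filter_subset _ _)
    have h1 := hexp X hXO (hXfib.trans (hlen s))
    have h2 : (M.filter (fun m => ∃ x ∈ X, Near x m)).card ≤ (I s).card := by
      refine (Finset.card_le_card ?_).trans (Finset.card_image_le (s := I s) (f := Prod.fst))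
      intro m hm
      obtain ⟨hmM, x, hx, b, hb⟩ := Finset.mem_filter.1 hm
      obtain ⟨hxf, hx1, hx2⟩ := Finset.mem_filter.1 hx
      obtain ⟨hxO, rfl⟩ := Finset.mem_filter.1 hxf
      refine Finset.mem_image.2 ⟨(m, b), hnear x hxO (m, b) (by simpa [Sides] using hmM) hb ?_, rfl⟩
      have hd : side b m - side b x = -1 ∨ side b m - side b x = 0 ∨
          side b m - side b x = 1 := by
        have := abs_le.1 hb
        omega
      rcases hd with hd | hd | hd <;> simp only [hd]
      · exact hx2
      · rwa [diagShift_zero]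
      · exact hx1
    have h3 : (fib s).card ≤ X.card + 2 := by
      have h4 := hnotlast s
      have h5 : ((fib s).filter (fun x => diagShift x 1 ∈ O)).card ≤ X.card +
          ((fib s).filter (fun x => diagShift x (-1) ∉ O)).card := by
        refine (Finset.card_le_card ?_).trans (Finset.card_union_le _ _)
        intro x hx
        simp only [X, Finset.mem_union, Finset.mem_filter] at hx ⊢
        tauto
      have h6 := hnotfirst s
      rw [← Finset.card_filter_add_card_filter_not (s := fib s)
        (fun x => diagShift x (-1) ∈ O)] at h6
      omega
    omega
  -- a streak with excess `1` is one node, a streak with excess `2` has a node at either end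
  let H : Finset ((ℤ × ℤ) × Bool) :=
    (S ×ˢ Finset.univ).filter (fun h => (I h.1).card + (bif h.2 then 2 else 1) ≤ (fib h.1).card)
  let e : (ℤ × ℤ) × Bool → Finset ((ℤ × ℤ) × Bool) := fun σ =>
    (O.filter (fun x => side σ.2 x = side σ.2 σ.1 + 1)).image (fun x => (st x, false)) ∪
    (O.filter (fun x => side σ.2 x = side σ.2 σ.1 - 1)).image
      (fun x => (st x, decide ((I (st x)).card + 2 ≤ (fib (st x)).card)))
  have he : ∀ σ ∈ Q, (e σ).card ≤ 2 := by
    intro σ _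
    have hone : ∀ a : ℤ, (O.filter (fun x => side σ.2 x = a)).card ≤ 1 := by
      intro a
      refine Finset.card_le_one.2 fun x hx y hy => ?_
      simp only [Finset.mem_filter] at hx hy
      exact hO.side_injOn hy.1 hx.1 σ.2 (hx.2.trans hy.2.symm)
    exact (Finset.card_union_le _ _).trans
      (add_le_add (Finset.card_image_le.trans (hone _)) (Finset.card_image_le.trans (hone _)))
  obtain ⟨c, hc, hcard⟩ := exists_labelling H Q e he
  let Qa : (ℤ × ℤ) × Bool → Finset ((ℤ × ℤ) × Bool) := fun a =>
    Q.filter (fun σ => ∃ u ∈ e σ, c u = a)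
  let Ha : (ℤ × ℤ) × Bool → Finset ((ℤ × ℤ) × Bool) := fun a => H.filter (fun u => c u = a)
  let P : (ℤ × ℤ) × Bool → ℤ × ℤ → Prop := fun a x =>
    ((fib (st x)).card = (I (st x)).card + 1 ∧ c (st x, false) = a) ∨
    ((fib (st x)).card = (I (st x)).card + 2 ∧
      ((c (st x, false) = a ∧ diagShift x 1 ∈ O) ∨
        (c (st x, true) = a ∧ diagShift x (-1) ∈ O)))
  let X : (ℤ × ℤ) × Bool → Finset (ℤ × ℤ) := fun a => O.filter (P a)
  let Sa : (ℤ × ℤ) × Bool → Finset (ℤ × ℤ) := fun a => (Ha a).image Prod.fst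
  have hnode : ∀ (x : ℤ × ℤ) (b : Bool), x ∈ O →
      (I (st x)).card + (bif b then 2 else 1) ≤ (fib (st x)).card →
      st x ∈ Sa (c (st x, b)) := by
    intro x b hx hle
    refine Finset.mem_image.2 ⟨(st x, b), Finset.mem_filter.2 ⟨?_, rfl⟩, rfl⟩
    refine Finset.mem_filter.2 ⟨Finset.mem_product.2 ⟨?_, Finset.mem_univ _⟩, hle⟩
    exact Finset.mem_image_of_mem st hx
  have hXnode : ∀ a, ∀ x ∈ X a, st x ∈ Sa a := by
    intro a x hx
    obtain ⟨hxO, ⟨h, rfl⟩ | ⟨h, ⟨rfl, -⟩ | ⟨rfl, -⟩⟩⟩ := Finset.mem_filter.1 hx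
    · exact hnode x false hxO h.ge
    · exact hnode x false hxO (by rw [h, cond_false]; omega)
    · exact hnode x true hxO h.ge
  have hXcard : ∀ a, ∑ s ∈ Sa a, (I s).card + (Ha a).card ≤ (X a).card := by
    intro a
    rw [Finset.card_eq_sum_card_image Prod.fst (Ha a),
      Finset.card_eq_sum_card_fiberwise (f := st) (s := X a) (t := Sa a) (hXnode a),
      ← Finset.sum_add_distrib]
    refine Finset.sum_le_sum fun s hs => ?_
    have hHs : ∀ h ∈ (Ha a).filter (fun h => h.1 = s),
        (h = (s, false) ∧ c (s, false) = a) ∨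
          (h = (s, true) ∧ c (s, true) = a ∧ (I s).card + 2 ≤ (fib s).card) := by
      rintro ⟨s', b⟩ hh
      simp only [Ha, H, Finset.mem_filter] at hh
      obtain ⟨⟨⟨-, hle⟩, hca⟩, rfl⟩ := hh
      cases b
      · exact Or.inl ⟨rfl, hca⟩
      · exact Or.inr ⟨rfl, hca, hle⟩
    have hpos : (I s).card + 1 ≤ (fib s).card ∧ ∃ h, h ∈ (Ha a).filter (fun h => h.1 = s) := by
      obtain ⟨⟨s', b⟩, hh, rfl⟩ := Finset.mem_image.1 hs
      refine ⟨?_, _, Finset.mem_filter.2 ⟨hh, rfl⟩⟩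
      have h : (I s').card + (bif b then 2 else 1) ≤ (fib s').card :=
        (Finset.mem_filter.1 (Finset.mem_filter.1 hh).1).2
      change (I s').card + 1 ≤ (fib s').card
      cases b <;> simp only [cond_true, cond_false] at h <;> omega
    obtain ⟨hpos, h₀, hh₀⟩ := hpos
    have hfibX : ∀ A ⊆ fib s, (∀ x ∈ A, P a x) →
        A.card ≤ ((X a).filter (fun x => st x = s)).card := by
      intro A hA hP
      refine Finset.card_le_card fun x hx => ?_
      have hx' := Finset.mem_filter.1 (hA hx)
      exact Finset.mem_filter.2 ⟨Finset.mem_filter.2 ⟨hx'.1, hP x hx⟩, hx'.2⟩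
    have hfst : ∀ x ∈ fib s, st x = s := fun x hx => (Finset.mem_filter.1 hx).2
    have hone : ∀ b, (∀ h ∈ (Ha a).filter (fun h => h.1 = s), h = (s, b)) →
        ((Ha a).filter (fun h => h.1 = s)).card ≤ 1 := by
      intro b hb
      exact Finset.card_le_one.2 fun u hu v hv => (hb u hu).trans (hb v hv).symm
    by_cases hf2 : (I s).card + 2 ≤ (fib s).card
    · have hf : (fib s).card = (I s).card + 2 := le_antisymm (hexcess s) hf2
      by_cases hcf : c (s, false) = a
      · by_cases hct : c (s, true) = a
        · have h1 : ((Ha a).filter (fun h => h.1 = s)).card ≤ 2 := by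
            refine (Finset.card_le_card (t := {(s, false), (s, true)}) fun h hh => ?_).trans
              Finset.card_le_two
            simp only [Finset.mem_insert, Finset.mem_singleton]
            rcases hHs h hh with h | h
            · exact Or.inl h.1
            · exact Or.inr h.1
          have h2 := hfibX (fib s) subset_rfl fun x hx => by
            simp only [P, hfst x hx, hf, hcf, hct, true_and]
            right
            by_contra! hno
            obtain ⟨y, hy, hyx⟩ := Finset.exists_mem_ne (by omega : 1 < (fib s).card) x
            exact hyx (hsingle x (Finset.mem_filter.1 hx).1 y (Finset.mem_filter.1 hy).1
              ((hfst x hx).trans (hfst y hy).symm) hno.2 hno.1).symm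
          omega
        · have h1 := hone false fun h hh => by
            rcases hHs h hh with h | h
            · exact h.1
            · exact absurd h.2.1 hct
          have h2 := hfibX _ (Finset.filter_subset (fun x => diagShift x 1 ∈ O) _)
            fun x hx => by
              obtain ⟨hx, hx1⟩ := Finset.mem_filter.1 hx
              simp only [P, hfst x hx]
              exact Or.inr ⟨hf, Or.inl ⟨hcf, hx1⟩⟩
          have h3 := hnotlast s
          omega
      · have hct : c (s, true) = a := by
          rcases hHs _ hh₀ with h | h
          · exact absurd h.2 hcf
          · exact h.2.1
        have h1 := hone true fun h hh => by
          rcases hHs h hh with h | h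
          · exact absurd h.2 hcf
          · exact h.1
        have h2 := hfibX _ (Finset.filter_subset (fun x => diagShift x (-1) ∈ O) _)
          fun x hx => by
            obtain ⟨hx, hx1⟩ := Finset.mem_filter.1 hx
            simp only [P, hfst x hx]
            exact Or.inr ⟨hf, Or.inr ⟨hct, hx1⟩⟩
        have h3 := hnotfirst s
        omega
    · have hfalse : ∀ h ∈ (Ha a).filter (fun h => h.1 = s),
          h = (s, false) ∧ c (s, false) = a := by
        intro h hh
        rcases hHs h hh with h | h
        · exact h
        · exact absurd h.2.2 hf2
      have h1 := hone false fun h hh => (hfalse h hh).1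
      have h2 := hfibX (fib s) subset_rfl fun x hx => by
        simp only [P, hfst x hx]
        exact Or.inl ⟨by omega, (hfalse _ hh₀).2⟩
      omega
  have hNcard : ∀ a, (M.filter (fun m => ∃ x ∈ X a, Near x m)).card ≤
      ∑ s ∈ Sa a, (I s).card + (Qa a).card := by
    intro a
    calc (M.filter (fun m => ∃ x ∈ X a, Near x m)).card
        ≤ (((Sa a).biUnion I ∪ Qa a).image Prod.fst).card := by
          refine Finset.card_le_card fun m hm => ?_
          obtain ⟨hmM, x, hx, b, hb⟩ := Finset.mem_filter.1 hm
          have hσ : (m, b) ∈ Sides := by simpa [Sides] using hmM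
          obtain ⟨hxO, hP⟩ := Finset.mem_filter.1 hx
          refine Finset.mem_image.2 ⟨(m, b), Finset.mem_union.2 ?_, rfl⟩
          by_cases hint : ∃ y ∈ O, side b y = side b m
          · obtain ⟨y, hy, hyb⟩ := hint
            refine Or.inl (Finset.mem_biUnion.2 ⟨st x, hXnode a x hx, hnear x hxO _ hσ hb ?_⟩)
            rwa [← hO.eq_diagShift hxO hy b hb (by rw [hyb]; ring)]
          · refine Or.inr (Finset.mem_filter.2 ⟨Finset.mem_filter.2 ⟨hσ, hint⟩, ?_⟩)
            have hnot : diagShift x (side b m - side b x) ∉ O := fun h =>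
              hint ⟨_, h, by rw [side_diagShift]; ring⟩
            have hd : side b m - side b x = -1 ∨ side b m - side b x = 0 ∨
                side b m - side b x = 1 := by
              have := abs_le.1 hb
              omega
            rcases hd with hd | hd | hd <;> rw [hd] at hnot
            · refine ⟨(st x, false), Finset.mem_union_left _ (Finset.mem_image.2
                ⟨x, Finset.mem_filter.2 ⟨hxO, ?_⟩, rfl⟩), ?_⟩
              · change side b x = side b m + 1
                omega
              · rcases hP with ⟨-, h⟩ | ⟨-, ⟨h, -⟩ | ⟨-, h⟩⟩
                · exact h
                · exact h
                · exact absurd h hnot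
            · rw [diagShift_zero] at hnot
              exact absurd hxO hnot
            · refine ⟨_, Finset.mem_union_right _ (Finset.mem_image.2
                ⟨x, Finset.mem_filter.2 ⟨hxO, ?_⟩, rfl⟩), ?_⟩
              · change side b x = side b m - 1
                omega
              · rcases hP with ⟨hf, h⟩ | ⟨hf, ⟨-, h⟩ | ⟨h, -⟩⟩
                · rwa [decide_eq_false (by omega)]
                · exact absurd h hnot
                · rwa [decide_eq_true (by omega)]
      _ ≤ ((Sa a).biUnion I ∪ Qa a).card := Finset.card_image_le
      _ ≤ ((Sa a).biUnion I).card + (Qa a).card := Finset.card_union_le _ _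
      _ ≤ _ := by
        gcongr
        exact Finset.card_biUnion_le
  have hclass : ∀ a, (t + 1) * (Ha a).card ≤ (t + 1) * (Qa a).card + (X a).card := by
    intro a
    by_cases hsmall : (X a).card ≤ t
    · have h1 := hexp (X a) (Finset.filter_subset _ _) hsmall
      have h2 := hXcard a
      have h3 := hNcard a
      have h4 : (Ha a).card ≤ (Qa a).card := by omega
      exact (Nat.mul_le_mul_left _ h4).trans (Nat.le_add_right _ _)
    · have h1 : (Ha a).card ≤ (Qa a).card + 1 := hcard a
      calc (t + 1) * (Ha a).card ≤ (t + 1) * ((Qa a).card + 1) := Nat.mul_le_mul_left _ h1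
        _ = (t + 1) * (Qa a).card + (t + 1) := by ring
        _ ≤ _ := by omega
  let L := H.image c
  have hHsum : H.card = ∑ a ∈ L, (Ha a).card := Finset.card_eq_sum_card_image c H
  have hQsum : ∑ a ∈ L, (Qa a).card ≤ Q.card := by
    rw [← Finset.card_biUnion]
    · exact Finset.card_le_card (Finset.biUnion_subset.2 fun a _ => Finset.filter_subset _ _)
    · intro a _ a' _ hne
      rw [Function.onFun, Finset.disjoint_left]
      intro σ h1 h2
      obtain ⟨hσ, u, hu, rfl⟩ := Finset.mem_filter.1 h1
      obtain ⟨-, v, hv, rfl⟩ := Finset.mem_filter.1 h2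
      exact hne (hc σ hσ u hu v hv)
  have hXsum : ∑ a ∈ L, (X a).card ≤ 2 * O.card := by
    have h := Finset.sum_card_bipartiteAbove_eq_sum_card_bipartiteBelow (s := L) (t := O) P
    simp only [Finset.bipartiteAbove, Finset.bipartiteBelow] at h
    change ∑ a ∈ L, (O.filter (P a)).card ≤ _
    rw [h, mul_comm, ← smul_eq_mul]
    refine Finset.sum_le_card_nsmul _ _ _ fun x _ => ?_
    refine (Finset.card_le_card (t := {c (st x, false), c (st x, true)}) ?_).trans
      Finset.card_le_two
    intro a ha
    have := (Finset.mem_filter.1 ha).2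
    simp only [P] at this
    simp only [Finset.mem_insert, Finset.mem_singleton]
    rcases this with ⟨-, h⟩ | ⟨-, ⟨h, -⟩ | ⟨h, -⟩⟩
    · exact Or.inl h.symm
    · exact Or.inl h.symm
    · exact Or.inr h.symm
  have hOsum : O.card ≤ ∑ s ∈ S, (I s).card + H.card := by
    have h1 : O.card = ∑ s ∈ S, (fib s).card := Finset.card_eq_sum_card_image st O
    have h2 : H.card = ∑ s ∈ S, (H.filter (fun h => h.1 = s)).card :=
      Finset.card_eq_sum_card_fiberwise fun h hh =>
        (Finset.mem_product.1 (Finset.mem_filter.1 hh).1).1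
    rw [h1, h2, ← Finset.sum_add_distrib]
    refine Finset.sum_le_sum fun s hs => ?_
    have h3 := hexcess s
    by_cases hf1 : (fib s).card ≤ (I s).card
    · omega
    have hm1 : (s, false) ∈ H.filter (fun h => h.1 = s) := by
      simp only [H, Finset.mem_filter, Finset.mem_product, Finset.mem_univ, cond_false]
      exact ⟨⟨⟨hs, trivial⟩, by omega⟩, trivial⟩
    by_cases hf2 : (fib s).card ≤ (I s).card + 1
    · have := Finset.card_pos.2 ⟨_, hm1⟩
      omega
    have hm2 : (s, true) ∈ H.filter (fun h => h.1 = s) := by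
      simp only [H, Finset.mem_filter, Finset.mem_product, Finset.mem_univ, cond_true]
      exact ⟨⟨⟨hs, trivial⟩, by omega⟩, trivial⟩
    have := Finset.one_lt_card.2 ⟨_, hm1, _, hm2, by simp⟩
    omega
  have hfinal : (t + 1) * H.card ≤ (t + 1) * Q.card + 2 * O.card := by
    calc (t + 1) * H.card = ∑ a ∈ L, (t + 1) * (Ha a).card := by rw [hHsum, Finset.mul_sum]
      _ ≤ ∑ a ∈ L, ((t + 1) * (Qa a).card + (X a).card) := Finset.sum_le_sum fun a _ => hclass a
      _ = (t + 1) * ∑ a ∈ L, (Qa a).card + ∑ a ∈ L, (X a).card := by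
        rw [Finset.sum_add_distrib, Finset.mul_sum]
      _ ≤ _ := add_le_add (Nat.mul_le_mul_left _ hQsum) hXsum
  nlinarith [Nat.mul_le_mul_left (t + 1) hOsum, Nat.mul_le_mul_left (t + 1) hIQ]
theorem Overlap.symm {n : ℕ} {e e' : Fin n × Fin n} (h : Overlap e e') : Overlap e' e := by
  unfold Overlap at *; omega

theorem Overlap.refl {n : ℕ} (e : Fin n × Fin n) : Overlap e e := by
  unfold Overlap; omega

/-- Two edges are compatible if they do not overlap or lie on a common diagonal. -/
def Compatible {n : ℕ} (e e' : Fin n × Fin n) : Prop :=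
  Overlap e e' → (e'.1.val : ℤ) - e.1.val = e'.2.val - e.2.val

theorem Compatible.symm {n : ℕ} {e e' : Fin n × Fin n} (h : Compatible e e') :
    Compatible e' e := fun h' => by
  have := h h'.symm
  omega

theorem Compatible.of_not_overlap {n : ℕ} {e e' : Fin n × Fin n} (h : ¬ Overlap e e') :
    Compatible e e' := fun h' => absurd h' h

theorem consecMatching_iff {n : ℕ} {E M : Finset (Fin n × Fin n)} :
    ConsecMatching E M ↔ M ⊆ E ∧ ∀ e ∈ M, ∀ e' ∈ M, Compatible e e' := by
  constructor
  · rintro ⟨h0, h1, h2, h3⟩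
    refine ⟨h0, fun e he e' he' ho => ?_⟩
    by_cases hee : e = e'
    · subst hee; simp
    obtain ⟨ha, hb⟩ := h1 e he e' he' hee
    rw [Ne, Fin.ext_iff] at ha hb
    have := h2 e he e' he'
    have := h2 e' he' e he
    have := h3 e he e' he'
    have := h3 e' he' e he
    unfold Overlap at ho
    omega
  · rintro ⟨h0, h⟩
    refine ⟨h0, fun e he e' he' hee => ?_, fun e he e' he' h1 => ?_, fun e he e' he' h1 => ?_⟩
    · have := h e he e' he'
      unfold Compatible Overlap at this
      rw [Ne, Prod.ext_iff, Fin.ext_iff, Fin.ext_iff] at hee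
      rw [Ne, Ne, Fin.ext_iff, Fin.ext_iff]
      omega
    · have := h e he e' he'
      unfold Compatible Overlap at this
      omega
    · have := h e he e' he'
      unfold Compatible Overlap at this
      omega

theorem ConsecMatching.compatible {n : ℕ} {E M : Finset (Fin n × Fin n)}
    (h : ConsecMatching E M) {e e' : Fin n × Fin n} (he : e ∈ M) (he' : e' ∈ M) :
    Compatible e e' := (consecMatching_iff.1 h).2 e he e' he'

theorem ConsecMatching.inter {n : ℕ} {E O : Finset (Fin n × Fin n)} (h : ConsecMatching E O)
    (F : Finset (Fin n × Fin n)) : ConsecMatching F (O ∩ F) :=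
  consecMatching_iff.2 ⟨Finset.inter_subset_right, fun _ he _ he' =>
    h.compatible (Finset.mem_inter.1 he).1 (Finset.mem_inter.1 he').1⟩

theorem NoRun.mono {n : ℕ} {E F : Finset (Fin n × Fin n)} {k : ℕ} (h : NoRun F k)
    (hEF : E ⊆ F) : NoRun E k := fun ⟨s, hs, hsE⟩ => h ⟨s, hs, hsE.trans hEF⟩

theorem NoRun.exists_missing {n : ℕ} {X : Finset (Fin n × Fin n)} {L : ℕ} (h : NoRun X L)
    (hL : 1 ≤ L) (p q : ℕ) :
    ∃ j < L, ∀ x ∈ X, ¬ (x.1.val = p + j ∧ x.2.val = q + j) := by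
  by_contra! hX
  obtain ⟨x, -, hx⟩ := hX (L - 1) (by omega)
  refine h ⟨Finset.univ.filter (fun e => ∃ r < L, e.1.val = p + r ∧ e.2.val = q + r),
    ⟨p, q, by omega, by omega, fun e => by simp⟩, fun e he => ?_⟩
  obtain ⟨r, hr, h1, h2⟩ := (Finset.mem_filter.1 he).2
  obtain ⟨y, hy, hy1, hy2⟩ := hX r hr
  rwa [show e = y from Prod.ext (Fin.ext (h1.trans hy1.symm)) (Fin.ext (h2.trans hy2.symm))]

theorem IsRunAt.card {n : ℕ} {s : Finset (Fin n × Fin n)} {p q ℓ : ℕ} (h : IsRunAt s p q ℓ) :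
    s.card = ℓ := by
  obtain ⟨hp, hq, h⟩ := h
  have hs : s.image (fun e => e.1.val - p) = Finset.range ℓ := by
    ext r
    simp only [Finset.mem_image, Finset.mem_range]
    constructor
    · rintro ⟨e, he, rfl⟩
      obtain ⟨r, hr, h1, -⟩ := (h e).1 he
      omega
    · intro hr
      exact ⟨(⟨p + r, by omega⟩, ⟨q + r, by omega⟩), (h _).2 ⟨r, hr, rfl, rfl⟩, by simp⟩
  rw [← Finset.card_range ℓ, ← hs, Finset.card_image_of_injOn]
  intro e he e' he' hee
  obtain ⟨r, hr, h1, h2⟩ := (h e).1 he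
  obtain ⟨r', hr', h1', h2'⟩ := (h e').1 he'
  simp only [] at hee
  exact Prod.ext (Fin.ext (by omega)) (Fin.ext (by omega))

theorem IsRun.card {n : ℕ} {s : Finset (Fin n × Fin n)} {ℓ : ℕ} (h : IsRun s ℓ) :
    s.card = ℓ := by
  obtain ⟨p, q, h⟩ := h
  exact h.card

theorem IsRun.compatible {n : ℕ} {s : Finset (Fin n × Fin n)} {ℓ : ℕ} (h : IsRun s ℓ)
    {e e' : Fin n × Fin n} (he : e ∈ s) (he' : e' ∈ s) : Compatible e e' := by
  obtain ⟨p, q, -, -, h⟩ := h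
  obtain ⟨r, hr, h1, h2⟩ := (h e).1 he
  obtain ⟨r', hr', h1', h2'⟩ := (h e').1 he'
  intro _
  omega

/-- If a coordinate `f` of a consecutive matching without runs of length `ℓ + 2` takes its
values in an interval of length `ℓ + 2`, it misses one of them. -/
theorem card_le_of_noRun {n : ℕ} {X : Finset (Fin n × Fin n)} {ℓ : ℕ} (a : ℕ)
    (f : Fin n × Fin n → ℕ) (hX : NoRun X (ℓ + 2))
    (hinj : ∀ x ∈ X, ∀ y ∈ X, f x = f y → x = y)
    (hsucc : ∀ x ∈ X, ∀ y ∈ X, f y = f x + 1 →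
      y.1.val = x.1.val + 1 ∧ y.2.val = x.2.val + 1)
    (ha : ∀ x ∈ X, a ≤ f x + 1 ∧ f x ≤ a + ℓ) : X.card ≤ ℓ + 1 := by
  by_contra! hcard
  have himg : X.image (fun x => f x + 1 - a) = Finset.range (ℓ + 2) := by
    refine Finset.eq_of_subset_of_card_le (fun r hr => ?_) ?_
    · obtain ⟨x, hx, rfl⟩ := Finset.mem_image.1 hr
      have := ha x hx
      exact Finset.mem_range.2 (by omega)
    · rw [Finset.card_range, Finset.card_image_of_injOn]
      · omega
      · intro x hx y hy hxy
        have := ha x hx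
        have := ha y hy
        simp only [] at hxy
        exact hinj x hx y hy (by omega)
  have hget : ∀ j < ℓ + 2, ∃ x ∈ X, f x + 1 = a + j := by
    intro j hj
    rw [← Finset.mem_range, ← himg] at hj
    obtain ⟨x, hx, rfl⟩ := Finset.mem_image.1 hj
    have := ha x hx
    exact ⟨x, hx, by omega⟩
  obtain ⟨x₀, hx₀, hfx₀⟩ := hget 0 (by omega)
  have hrun : ∀ j < ℓ + 2, ∃ x ∈ X, f x + 1 = a + j ∧
      x.1.val = x₀.1.val + j ∧ x.2.val = x₀.2.val + j := by
    intro j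
    induction j with
    | zero => exact fun _ => ⟨x₀, hx₀, hfx₀, rfl, rfl⟩
    | succ j ih =>
      intro hj
      obtain ⟨x, hx, hfx, h1, h2⟩ := ih (by omega)
      obtain ⟨y, hy, hfy⟩ := hget (j + 1) hj
      have := hsucc x hx y hy (by omega)
      exact ⟨y, hy, hfy, by omega, by omega⟩
  obtain ⟨j, hj, hmiss⟩ := hX.exists_missing (by omega) x₀.1.val x₀.2.val
  obtain ⟨x, hx, -, hx'⟩ := hrun j hj
  exact hmiss x hx hx'

theorem card_le_of_overlap_run {n : ℕ} {E X s : Finset (Fin n × Fin n)} {ℓ : ℕ}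
    (hX : ConsecMatching E X) (hs : IsRun s ℓ) (hno : NoRun X (ℓ + 2))
    (hov : ∀ x ∈ X, ∃ e ∈ s, Overlap x e) : X.card ≤ 2 * ℓ + 2 := by
  obtain ⟨p, q, -, -, hs⟩ := hs
  have hbd : ∀ x ∈ X, (p ≤ x.1.val + 1 ∧ x.1.val ≤ p + ℓ) ∨
      (q ≤ x.2.val + 1 ∧ x.2.val ≤ q + ℓ) := by
    intro x hx
    obtain ⟨e, he, hxe⟩ := hov x hx
    obtain ⟨r, hr, h1, h2⟩ := (hs e).1 he
    unfold Overlap at hxe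
    omega
  have hA : (X.filter (fun x => p ≤ x.1.val + 1 ∧ x.1.val ≤ p + ℓ)).card ≤ ℓ + 1 := by
    refine card_le_of_noRun p (fun x => x.1.val) (hno.mono (Finset.filter_subset _ _))
      (fun x hx y hy hxy => ?_) (fun x hx y hy hxy => ?_)
      (fun x hx => (Finset.mem_filter.1 hx).2)
    all_goals
      have := hX.compatible (Finset.mem_filter.1 hx).1 (Finset.mem_filter.1 hy).1
      unfold Compatible Overlap at this
    · exact Prod.ext (Fin.ext (by omega)) (Fin.ext (by omega))
    · omega
  have hB : (X.filter (fun x => q ≤ x.2.val + 1 ∧ x.2.val ≤ q + ℓ)).card ≤ ℓ + 1 := by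
    refine card_le_of_noRun q (fun x => x.2.val) (hno.mono (Finset.filter_subset _ _))
      (fun x hx y hy hxy => ?_) (fun x hx y hy hxy => ?_)
      (fun x hx => (Finset.mem_filter.1 hx).2)
    all_goals
      have := hX.compatible (Finset.mem_filter.1 hx).1 (Finset.mem_filter.1 hy).1
      unfold Compatible Overlap at this
    · exact Prod.ext (Fin.ext (by omega)) (Fin.ext (by omega))
    · omega
  have hcover : X ⊆ X.filter (fun x => p ≤ x.1.val + 1 ∧ x.1.val ≤ p + ℓ) ∪
      X.filter (fun x => q ≤ x.2.val + 1 ∧ x.2.val ≤ q + ℓ) := by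
    intro x hx
    simpa only [Finset.mem_union, Finset.mem_filter, hx, true_and] using hbd x hx
  have := (Finset.card_le_card hcover).trans (Finset.card_union_le _ _)
  omega

/-- A small part of a consecutive matching does not overlap fewer edges of a locally optimal
matching than it has itself. -/
theorem LocallyOptimal.card_le {n : ℕ} {E M O : Finset (Fin n × Fin n)} {t : ℕ}
    (hM : LocallyOptimal E M t) (hO : ConsecMatching E O) {X : Finset (Fin n × Fin n)}
    (hXO : X ⊆ O) (hX : X.card ≤ t) :
    X.card ≤ (M.filter (fun m => ∃ x ∈ X, Overlap x m)).card := by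
  classical
  obtain ⟨hMc, hopt⟩ := hM
  set R := M.filter (fun m => ∃ x ∈ X \ M, ¬ Compatible x m) with hR
  have hle : (X \ M).card ≤ R.card := by
    by_contra! hlt
    refine hopt ⟨R, X \ M, Finset.filter_subset _ _,
      Finset.sdiff_subset_sdiff (hXO.trans hO.1) subset_rfl, hlt,
      (Finset.card_le_card Finset.sdiff_subset).trans hX, consecMatching_iff.2 ⟨?_, ?_⟩⟩
    · exact Finset.union_subset (Finset.sdiff_subset.trans hMc.1)
        (Finset.sdiff_subset.trans (hXO.trans hO.1))
    · have hcross : ∀ m ∈ M \ R, ∀ x ∈ X \ M, Compatible x m := by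
        intro m hm x hx
        by_contra hc
        obtain ⟨hmM, hmR⟩ := Finset.mem_sdiff.1 hm
        exact hmR (Finset.mem_filter.2 ⟨hmM, x, hx, hc⟩)
      intro e he e' he'
      rcases Finset.mem_union.1 he with he | he <;> rcases Finset.mem_union.1 he' with he' | he'
      · exact hMc.compatible (Finset.mem_sdiff.1 he).1 (Finset.mem_sdiff.1 he').1
      · exact (hcross e he e' he').symm
      · exact hcross e' he' e he
      · exact hO.compatible (hXO (Finset.mem_sdiff.1 he).1) (hXO (Finset.mem_sdiff.1 he').1)
  have hdisj : Disjoint R (X ∩ M) := by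
    refine Finset.disjoint_left.2 fun m hm hmX => ?_
    obtain ⟨-, x, hx, hc⟩ := Finset.mem_filter.1 hm
    exact hc (hO.compatible (hXO (Finset.mem_sdiff.1 hx).1) (hXO (Finset.mem_inter.1 hmX).1))
  calc X.card = (X \ M).card + (X ∩ M).card := (Finset.card_sdiff_add_card_inter X M).symm
    _ ≤ R.card + (X ∩ M).card := by gcongr
    _ = (R ∪ (X ∩ M)).card := (Finset.card_union_of_disjoint hdisj).symm
    _ ≤ _ := by
      refine Finset.card_le_card (Finset.union_subset (fun m hm => ?_) fun m hm => ?_)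
      · obtain ⟨hmM, x, hx, hc⟩ := Finset.mem_filter.1 hm
        exact Finset.mem_filter.2 ⟨hmM, x, (Finset.mem_sdiff.1 hx).1,
          by_contra fun h => hc (Compatible.of_not_overlap h)⟩
      · obtain ⟨hmX, hmM⟩ := Finset.mem_inter.1 hm
        exact Finset.mem_filter.2 ⟨hmM, m, hmX, Overlap.refl m⟩

/-- An edge seen as a point of the integer grid. -/
def gridPoint {n : ℕ} : Fin n × Fin n ↪ ℤ × ℤ where
  toFun e := ((e.1.val : ℤ), (e.2.val : ℤ))
  inj' e e' h := by
    simp only [Prod.mk.injEq, Nat.cast_inj] at h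
    exact Prod.ext (Fin.ext h.1) (Fin.ext h.2)

theorem gridPoint_apply {n : ℕ} (e : Fin n × Fin n) :
    gridPoint e = ((e.1.val : ℤ), (e.2.val : ℤ)) := rfl

theorem near_gridPoint {n : ℕ} {e e' : Fin n × Fin n} :
    Near (gridPoint e) (gridPoint e') ↔ Overlap e e' := by
  simp only [Near, Overlap, side, gridPoint_apply, Bool.exists_bool,
    cond_true, cond_false, abs_le]
  omega

theorem LocallyOptimal.mul_card_le {n : ℕ} {E M O : Finset (Fin n × Fin n)} {k t : ℕ}
    (hM : LocallyOptimal E M t) (hO : ConsecMatching E O) (hE : NoRun E k) (hk : 1 ≤ k)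
    (hkt : k ≤ t) : (t + 1) * O.card ≤ (t + 1) * (2 * M.card) + 2 * O.card := by
  classical
  have h := card_le_of_small_expansion (O := O.map gridPoint) (M := M.map gridPoint) (t := t)
    ?_ ?_ ?_
  · simpa only [Finset.card_map] using h
  · intro x hx y hy hxy
    obtain ⟨e, he, rfl⟩ := Finset.mem_map.1 hx
    obtain ⟨e', he', rfl⟩ := Finset.mem_map.1 hy
    exact hO.compatible he he' (near_gridPoint.1 hxy)
  · intro p
    by_contra! hp
    obtain ⟨e, he, hep⟩ := Finset.mem_map.1 (hp 0 (by omega))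
    obtain ⟨j, hj, hmiss⟩ := (hE.mono hO.1).exists_missing hk e.1.val e.2.val
    obtain ⟨e', he', hep'⟩ := Finset.mem_map.1 (hp j (by omega))
    refine hmiss e' he' ?_
    simp only [gridPoint_apply, diagShift, Prod.ext_iff] at hep hep'
    omega
  · intro X hX hXt
    obtain ⟨Y, hY, rfl⟩ := Finset.subset_map_iff.1 hX
    rw [Finset.card_map] at hXt ⊢
    refine (hM.card_le hO hY hXt).trans ?_
    rw [← Finset.card_map gridPoint]
    refine Finset.card_le_card fun x hx => ?_
    obtain ⟨m, hm, rfl⟩ := Finset.mem_map.1 hx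
    obtain ⟨hmM, y, hy, hym⟩ := Finset.mem_filter.1 hm
    exact Finset.mem_filter.2 ⟨Finset.mem_map_of_mem _ hmM, gridPoint y,
      Finset.mem_map_of_mem _ hy, near_gridPoint.2 hym⟩

/-- combining a greedy sequence with threshold `⌈2/ε⌉` with a
`(⌈4/ε⌉+1)`-locally-optimal consecutive matching of the remaining graph `E'`
yields a consecutive matching `ALG` in `E` with `(2 + ε)·|ALG| ≥ |O|` for every
consecutive matching `O` in `E`. -/
theorem greedy_plus_local_search {n : ℕ} (hn : 1 ≤ n) (ε : ℝ) (hε : 0 < ε)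
    (E : Finset (Fin n × Fin n)) (m : ℕ) (s : ℕ → Finset (Fin n × Fin n))
    (hgreedy : GreedySeq E ⌈2 / ε⌉₊ m s)
    (E' : Finset (Fin n × Fin n))
    (hE' : E' = E.filter (fun e => ∀ i < m, ∀ e' ∈ s i, ¬ Overlap e e'))
    (hnorun : NoRun E' ⌈2 / ε⌉₊)
    (M' : Finset (Fin n × Fin n)) (hM' : LocallyOptimal E' M' (⌈4 / ε⌉₊ + 1)) :
    ConsecMatching E ((Finset.range m).biUnion s ∪ M') ∧
    ∀ O : Finset (Fin n × Fin n), ConsecMatching E O →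
      (2 + ε) * ((((Finset.range m).biUnion s ∪ M').card : ℕ) : ℝ) ≥ (O.card : ℝ) := by
  classical
  set k := ⌈2 / ε⌉₊ with hk
  have hk1 : 1 ≤ k := Nat.one_le_iff_ne_zero.2 (Nat.ceil_pos.2 (by positivity)).ne'
  have hk2 : 2 ≤ ε * k := by
    have := Nat.le_ceil (2 / ε)
    rw [div_le_iff₀ hε] at this
    linarith
  have hcompat : ∀ i < m, ∀ e ∈ s i, ∀ e' ∈ s i, Compatible e e' := by
    intro i hi e he e' he'
    obtain ⟨-, ⟨ℓ, -, hℓ⟩, -⟩ := hgreedy i hi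
    exact hℓ.compatible he he'
  have hlt : ∀ i < m, ∀ j < i, ∀ e ∈ s i, ∀ e' ∈ s j, ¬ Overlap e e' :=
    fun i hi j hj e he => (Finset.mem_filter.1 ((hgreedy i hi).1 he)).2 j hj
  have hne : ∀ i < m, ∀ j < m, i ≠ j → ∀ e ∈ s i, ∀ e' ∈ s j, ¬ Overlap e e' := by
    intro i hi j hj hij e he e' he'
    rcases lt_or_gt_of_ne hij with h | h
    · exact fun ho => hlt j hj i h e' he' e he ho.symm
    · exact hlt i hi j h e he e' he'
  have hM'E : ∀ e ∈ M', e ∈ E ∧ ∀ i < m, ∀ e' ∈ s i, ¬ Overlap e e' := by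
    intro e he
    have := hM'.1.1 he
    rw [hE'] at this
    exact Finset.mem_filter.1 this
  constructor
  · refine consecMatching_iff.2 ⟨Finset.union_subset (Finset.biUnion_subset.2 fun i hi =>
      (hgreedy i (Finset.mem_range.1 hi)).1.trans (Finset.filter_subset _ _))
      fun e he => (hM'E e he).1, ?_⟩
    intro e he e' he'
    simp only [Finset.mem_union, Finset.mem_biUnion, Finset.mem_range] at he he'
    rcases he with ⟨i, hi, he⟩ | he <;> rcases he' with ⟨j, hj, he'⟩ | he'
    · by_cases hij : i = j
      · subst hij
        exact hcompat i hi e he e' he'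
      · exact .of_not_overlap (hne i hi j hj hij e he e' he')
    · exact (Compatible.of_not_overlap ((hM'E e' he').2 i hi e he)).symm
    · exact .of_not_overlap ((hM'E e he).2 j hj e' he')
    · exact hM'.1.compatible he he'
  intro O hO
  have hALG : ((Finset.range m).biUnion s ∪ M').card
      = ∑ i ∈ Finset.range m, (s i).card + M'.card := by
    rw [Finset.card_union_of_disjoint, Finset.card_biUnion]
    · intro i hi j hj hij
      exact Finset.disjoint_left.2 fun e he he' =>
        hne i (Finset.mem_range.1 hi) j (Finset.mem_range.1 hj) hij e he e he' (.refl e)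
    · refine Finset.disjoint_left.2 fun e he he' => ?_
      obtain ⟨i, hi, he⟩ := Finset.mem_biUnion.1 he
      exact (hM'E e he').2 i (Finset.mem_range.1 hi) e he (.refl e)
  set P : ℕ → Finset (Fin n × Fin n) := fun i => O.filter (fun x =>
    (∃ e ∈ s i, Overlap x e) ∧ ∀ j < i, ∀ e' ∈ s j, ¬ Overlap x e') with hP
  have hPcard : ∀ i ∈ Finset.range m, ((P i).card : ℝ) ≤ (2 + ε) * (s i).card := by
    intro i hi
    obtain ⟨-, ⟨ℓ, hkℓ, hℓ⟩, hmax⟩ := hgreedy i (Finset.mem_range.1 hi)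
    rw [hℓ.card] at hmax ⊢
    have hbound : (P i).card ≤ 2 * ℓ + 2 := by
      refine card_le_of_overlap_run (E := E) (consecMatching_iff.2
        ⟨(Finset.filter_subset _ _).trans hO.1, fun e he e' he' => hO.compatible
          (Finset.mem_filter.1 he).1 (Finset.mem_filter.1 he').1⟩) hℓ ?_
        fun x hx => (Finset.mem_filter.1 hx).2.1
      rintro ⟨r, hr, hrP⟩
      have := hmax r (ℓ + 2) hr fun x hx => by
        obtain ⟨hxO, -, hx'⟩ := Finset.mem_filter.1 (hrP hx)
        exact Finset.mem_filter.2 ⟨hO.1 hxO, hx'⟩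
      omega
    have h1 : ((P i).card : ℝ) ≤ 2 * ℓ + 2 := by exact_mod_cast hbound
    have h2 : ε * k ≤ ε * ℓ := by gcongr
    linarith
  have hrest : ((O ∩ E').card : ℝ) ≤ (2 + ε) * M'.card := by
    set c := ⌈4 / ε⌉₊ with hc
    have hkc : k ≤ c := Nat.ceil_mono (by gcongr; norm_num)
    have hc4 : 4 ≤ ε * c := by
      have := Nat.le_ceil (4 / ε)
      rw [div_le_iff₀ hε] at this
      linarith
    have h := hM'.mul_card_le (hO.inter E') hnorun hk1 (by omega)
    have h' : ((c : ℝ) + 1 + 1) * (O ∩ E').card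
        ≤ (c + 1 + 1) * (2 * M'.card) + 2 * (O ∩ E').card := by exact_mod_cast h
    have hcpos : (0 : ℝ) < c := by
      have : 0 < c := by omega
      exact_mod_cast this
    have hMnn : (0 : ℝ) ≤ M'.card := Nat.cast_nonneg _
    refine le_of_mul_le_mul_left ?_ hcpos
    nlinarith [mul_le_mul_of_nonneg_right hc4 hMnn]
  have hcover : O ⊆ (Finset.range m).biUnion P ∪ (O ∩ E') := by
    intro x hx
    by_cases hex : ∃ i, i < m ∧ ∃ e ∈ s i, Overlap x e
    · obtain ⟨hi, he⟩ := Nat.find_spec hex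
      refine Finset.mem_union_left _ (Finset.mem_biUnion.2
        ⟨Nat.find hex, Finset.mem_range.2 hi, Finset.mem_filter.2 ⟨hx, he, ?_⟩⟩)
      exact fun j hj e' he' ho => Nat.find_min hex hj ⟨hj.trans hi, e', he', ho⟩
    · push Not at hex
      refine Finset.mem_union_right _ (Finset.mem_inter.2 ⟨hx, ?_⟩)
      rw [hE']
      exact Finset.mem_filter.2 ⟨hO.1 hx, hex⟩
  have hOcard : O.card ≤ ∑ i ∈ Finset.range m, (P i).card + (O ∩ E').card :=
    ((Finset.card_le_card hcover).trans (Finset.card_union_le _ _)).trans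
      (Nat.add_le_add_right Finset.card_biUnion_le _)
  rw [ge_iff_le, hALG]
  calc (O.card : ℝ) ≤ ∑ i ∈ Finset.range m, ((P i).card : ℝ) + (O ∩ E').card := by
        exact_mod_cast hOcard
    _ ≤ ∑ i ∈ Finset.range m, (2 + ε) * ((s i).card : ℝ) + (2 + ε) * M'.card :=
        add_le_add (Finset.sum_le_sum hPcard) hrest
    _ = _ := by
        rw [← Finset.mul_sum, ← mul_add]
        push_cast
        rfl
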